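/- arXiv:1209.1129 — 9 statements merged into one kernel-verified Lean document; each statement's English description precedes it below -/
import Mathlib

section
/- Under hypotheses (29)–(31), for every continuous linear form L : V → ℝ the abstract nonlinear variational equation Φ(u, v) = L(v) for all v ∈ V has exactly one solution ū ∈ V. -/
/-- **Zarantonello's theorem**: a Lipschitz, strongly monotone operator on a real Hilbert space
is bijective. -/
theorem Function.Bijective.of_lipschitz_of_stronglyMonotone
    {V : Type*} [NormedAddCommGroup V] [InnerProductSpace ℝ V] [CompleteSpace V]
    {A : V → V} {B D : ℝ} (hB : 0 < B) (hD : 0 < D)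
    (hLip : ∀ x y, ‖A x - A y‖ ≤ D * ‖x - y‖)
    (hMono : ∀ x y, B * ‖x - y‖ ^ 2 ≤ inner ℝ (A x - A y) (x - y)) :
    Function.Bijective A := by
  refine ⟨fun x y hxy => ?_, fun f => ?_⟩
  · have h := hMono x y
    rw [hxy, sub_self, inner_zero_left] at h
    have h0 : ‖x - y‖ ^ 2 = 0 := by nlinarith [sq_nonneg ‖x - y‖]
    exact sub_eq_zero.mp (norm_eq_zero.mp (pow_eq_zero_iff two_ne_zero |>.mp h0))
  set t : ℝ := B / D ^ 2 with ht
  have ht0 : 0 < t := by positivity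
  have htD : t * D ^ 2 = B := by rw [ht]; field_simp
  set c : ℝ := 1 - t * B with hc
  have hc1 : √c < 1 := by
    rw [Real.sqrt_lt' one_pos]
    nlinarith [mul_pos ht0 hB]
  have hcontr : ContractingWith ⟨√c, Real.sqrt_nonneg c⟩ (fun u => u - t • (A u - f)) := by
    refine ⟨by exact_mod_cast hc1, LipschitzWith.of_dist_le_mul fun x y => ?_⟩
    have hstep : (x - t • (A x - f)) - (y - t • (A y - f)) = (x - y) - t • (A x - A y) := by
      module
    rw [dist_eq_norm, dist_eq_norm, hstep]
    have hsq : ‖(x - y) - t • (A x - A y)‖ ^ 2 ≤ ‖x - y‖ ^ 2 * c := by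
      rw [norm_sub_sq_real, inner_smul_right, real_inner_comm, norm_smul, Real.norm_eq_abs,
        abs_of_pos ht0]
      have h1 : ‖A x - A y‖ ^ 2 ≤ D ^ 2 * ‖x - y‖ ^ 2 := by
        rw [← mul_pow]
        exact pow_le_pow_left₀ (norm_nonneg _) (hLip x y) 2
      have h2 := mul_le_mul_of_nonneg_left h1 (sq_nonneg t)
      have h3 := mul_le_mul_of_nonneg_left (hMono x y) ht0.le
      have h4 : t ^ 2 * (D ^ 2 * ‖x - y‖ ^ 2) = t * B * ‖x - y‖ ^ 2 := by
        rw [← htD]; ring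
      rw [h4] at h2
      rw [mul_pow, hc]
      linarith
    calc ‖(x - y) - t • (A x - A y)‖ ≤ √(‖x - y‖ ^ 2 * c) := Real.le_sqrt_of_sq_le hsq
      _ = √c * ‖x - y‖ := by
        rw [Real.sqrt_mul (sq_nonneg _), Real.sqrt_sq (norm_nonneg _), mul_comm]
  have hfix : hcontr.fixedPoint - t • (A hcontr.fixedPoint - f) = hcontr.fixedPoint :=
    hcontr.fixedPoint_isFixedPt
  rw [sub_eq_self, smul_eq_zero_iff_right ht0.ne', sub_eq_zero] at hfix
  exact ⟨_, hfix⟩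

/-- Under hypotheses (29)–(31), for every continuous linear form
`L : V → ℝ` the abstract nonlinear variational equation `Φ(u, v) = L(v)` for all
`v ∈ V` has exactly one solution `ū ∈ V`. -/
theorem abstract_variational_equation_unique_solution
    {V : Type*} [NormedAddCommGroup V] [InnerProductSpace ℝ V] [CompleteSpace V]
    (Φ : V → V → ℝ)
    (hΦlin : ∀ u : V, IsLinearMap ℝ (Φ u))
    (h29 : ∀ u : V, ∃ RΦ > (0:ℝ), ∀ v : V, |Φ u v| ≤ RΦ * ‖v‖)
    (h30 : ∃ DΦ > (0:ℝ), ∀ u v w : V, |Φ (u + w) v - Φ u v| ≤ DΦ * ‖w‖ * ‖v‖)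
    (h31 : ∃ BΦ > (0:ℝ), ∀ u v : V, Φ (u + v) v - Φ u v ≥ BΦ * ‖v‖ ^ 2)
    (L : V →L[ℝ] ℝ) :
    ∃! u : V, ∀ v : V, Φ u v = L v := by
  choose R _ hR using h29
  obtain ⟨D, hD, hLip⟩ := h30
  obtain ⟨B, hB, hMono⟩ := h31
  let A : V → V := fun u =>
    (InnerProductSpace.toDual ℝ V).symm (((hΦlin u).mk' (Φ u)).mkContinuous (R u) (hR u))
  have hA (u v : V) : inner ℝ (A u) v = Φ u v := InnerProductSpace.toDual_symm_apply
  have hbij : Function.Bijective A := by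
    refine .of_lipschitz_of_stronglyMonotone hB hD (fun x y => ?_) fun x y => ?_
    · have h := (le_abs_self _).trans (hLip y (A x - A y) (x - y))
      rw [add_sub_cancel, ← hA, ← hA, ← inner_sub_left, real_inner_self_eq_norm_sq, sq] at h
      rcases (norm_nonneg (A x - A y)).eq_or_lt with h0 | h0
      · rw [← h0]; positivity
      · exact le_of_mul_le_mul_right h h0
    · have h := hMono y (x - y)
      rwa [add_sub_cancel, ← hA, ← hA, ← inner_sub_left] at h
  have hiff (u : V) : (∀ v, Φ u v = L v) ↔ A u = (InnerProductSpace.toDual ℝ V).symm L := by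
    rw [ext_iff_inner_right ℝ]
    simp only [hA, InnerProductSpace.toDual_symm_apply]
  simp only [hiff]
  exact hbij.existsUnique _
end

section
/- Theorem 1 (convergence): suppose Φ satisfies conditions (29)–(31), G is a symmetric bilinear form continuous with constant M_G > 0 and coercive with constant B_G > 0, L is a continuous linear form, and γ ∈ (0, 2γ*) where γ* = B_Φ B_G / D_Φ². Let ū ∈ V be the solution of Φ(ū, v) = L(v) for all v ∈ V, and let the sequence (u^k) ⊂ V be generated from any u⁰ ∈ V by G(u^{k+1}, v) = G(u^k, v) − γ[Φ(u^k, v) − L(v)] for all v ∈ V, k = 0, 1, …. Then ‖u^k − ū‖ → 0 as k → ∞. -/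
open Filter Topology in
/-- If a nonnegative sequence `g` decreases at each step by at least `c * a k ^ 2` with `c > 0`
and `a k ≥ 0`, then `a` tends to zero. -/
lemma tendsto_zero_of_sq_le_decrease {g a : ℕ → ℝ} {c : ℝ} (hc : 0 < c)
    (hg : ∀ k, 0 ≤ g k) (ha : ∀ k, 0 ≤ a k) (hstep : ∀ k, g (k + 1) ≤ g k - c * a k ^ 2) :
    Tendsto a atTop (𝓝 0) := by
  have hanti : Antitone g := antitone_nat_of_succ_le fun k => by
    nlinarith [hstep k, mul_nonneg hc.le (sq_nonneg (a k))]
  have hlim := tendsto_atTop_ciInf hanti ⟨0, by rintro _ ⟨k, rfl⟩; exact hg k⟩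
  have hdiff : Tendsto (fun k => (g k - g (k + 1)) / c) atTop (𝓝 0) := by
    simpa using (hlim.sub ((tendsto_add_atTop_iff_nat 1).mpr hlim)).div_const c
  have hsq : Tendsto (fun k => a k ^ 2) atTop (𝓝 0) :=
    squeeze_zero (fun k => sq_nonneg _)
      (fun k => by rw [le_div_iff₀ hc]; linarith [hstep k]) hdiff
  simpa [Real.sqrt_sq (ha _)] using hsq.sqrt

/-- A bound on the residual transfers to the coercive energy: if `b * d ^ 2 ≤ q` and `q ≤ r * d`,
then `q ≤ r ^ 2 / b`. -/
lemma le_sq_div_of_mul_sq_le {b d q r : ℝ} (hb : 0 < b) (hlow : b * d ^ 2 ≤ q)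
    (hup : q ≤ r * d) : q ≤ r ^ 2 / b := by
  rw [le_div_iff₀ hb]
  nlinarith [sq_nonneg (b * d - r)]

/-- Theorem 1, convergence: if `Φ` satisfies (29)–(31), `G` is a symmetric
bilinear form, continuous with constant `M_G > 0` and coercive with constant `B_G > 0`,
`L` is a continuous linear form, and `γ ∈ (0, 2γ*)` with `γ* = B_Φ B_G / D_Φ²`, then for
`ū` the solution of `Φ(ū, v) = L(v)` for all `v`, and `(u^k)` generated from any `u⁰` by
`G(u^{k+1}, v) = G(u^k, v) − γ[Φ(u^k, v) − L(v)]`, one has `‖u^k − ū‖ → 0`. -/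
theorem iterative_method_convergence
    {V : Type*} [NormedAddCommGroup V] [InnerProductSpace ℝ V] [CompleteSpace V]
    (Φ : V → V → ℝ)
    (hΦlin : ∀ u : V, IsLinearMap ℝ (Φ u))
    (h29 : ∀ u : V, ∃ RΦ > (0:ℝ), ∀ v : V, |Φ u v| ≤ RΦ * ‖v‖)
    (DΦ : ℝ) (hDΦ : DΦ > 0)
    (h30 : ∀ u v w : V, |Φ (u + w) v - Φ u v| ≤ DΦ * ‖w‖ * ‖v‖)
    (BΦ : ℝ) (hBΦ : BΦ > 0)
    (h31 : ∀ u v : V, Φ (u + v) v - Φ u v ≥ BΦ * ‖v‖ ^ 2)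
    (G : V → V → ℝ)
    (hGlin₁ : ∀ u : V, IsLinearMap ℝ (G u))
    (hGlin₂ : ∀ v : V, IsLinearMap ℝ (fun u => G u v))
    (hGsymm : ∀ u v : V, G u v = G v u)
    (MG : ℝ) (hMG : MG > 0)
    (hGcont : ∀ u v : V, |G u v| ≤ MG * ‖u‖ * ‖v‖)
    (BG : ℝ) (hBG : BG > 0)
    (hGcoer : ∀ u : V, G u u ≥ BG * ‖u‖ ^ 2)
    (L : V →L[ℝ] ℝ)
    (γ : ℝ) (hγ : γ ∈ Set.Ioo (0:ℝ) (2 * (BΦ * BG / DΦ ^ 2)))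
    (ub : V) (hub : ∀ v : V, Φ ub v = L v)
    (u : ℕ → V)
    (hstep : ∀ k : ℕ, ∀ v : V, G (u (k + 1)) v = G (u k) v - γ * (Φ (u k) v - L v)) :
    Filter.Tendsto (fun k => ‖u k - ub‖) Filter.atTop (nhds 0) := by
  obtain ⟨hγ0, hγ1⟩ := hγ
  have hc : 0 < 2 * γ * BΦ - (γ * DΦ) ^ 2 / BG := by
    rw [← mul_div_assoc, lt_div_iff₀ (by positivity)] at hγ1
    rw [sub_pos, div_lt_iff₀ hBG]
    nlinarith [mul_lt_mul_of_pos_left hγ1 hγ0]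
  refine tendsto_zero_of_sq_le_decrease (g := fun k => G (u k - ub) (u k - ub)) hc
    (fun k => le_trans (by positivity) (hGcoer _)) (fun k => norm_nonneg _) fun k => ?_
  obtain ⟨e, he⟩ : ∃ e, e = u k - ub := ⟨_, rfl⟩
  obtain ⟨d, hd⟩ : ∃ d, d = u (k + 1) - u k := ⟨_, rfl⟩
  have huk : u k = ub + e := by rw [he]; abel
  have hsucc : u (k + 1) - ub = e + d := by rw [he, hd]; abel
  have hres (v : V) : G d v = -γ * (Φ (ub + e) v - Φ ub v) := by
    have hsub : G d v = G (u (k + 1)) v - G (u k) v := hd ▸ (hGlin₂ v).map_sub _ _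
    rw [hsub, hstep, hub, huk]
    ring
  have hexpand : G (e + d) (e + d) = G e e + 2 * G d e + G d d := by
    have hadd (v : V) : G (e + d) v = G e v + G d v := (hGlin₂ v).map_add _ _
    rw [(hGlin₁ (e + d)).map_add, hadd, hadd, hGsymm e d]
    ring
  have hde : G d e ≤ -γ * (BΦ * ‖e‖ ^ 2) := by
    rw [hres]
    nlinarith [mul_le_mul_of_nonneg_left (h31 ub e) hγ0.le]
  have hdd : G d d ≤ (γ * DΦ * ‖e‖) ^ 2 / BG := by
    refine le_sq_div_of_mul_sq_le hBG (hGcoer d) ?_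
    rw [hres]
    nlinarith [mul_le_mul_of_nonneg_left (neg_le_of_abs_le (h30 ub d e)) hγ0.le]
  have hsplit : (γ * DΦ * ‖e‖) ^ 2 / BG = (γ * DΦ) ^ 2 / BG * ‖e‖ ^ 2 := by ring
  simp only [hsucc, ← he, hexpand]
  linarith
end

section
/- Convergence estimate in the original norm: under hypotheses (29)–(31) on Φ, with G symmetric, continuous with constant M_G > 0 and coercive with constant B_G > 0, γ ∈ (0, 2B_Φ B_G/D_Φ²), ū the solution of Φ(ū, v) = L(v) for all v ∈ V, and (u^k) generated by method (28), one has ‖u^k − ū‖² ≤ (M_G/B_G) · q(γ)^{2k} · ‖u⁰ − ū‖² for all k, where q(γ)² = 1 − (2γB_Φ − γ²D_Φ²/B_G)/M_G. -/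
/-- If a nonnegative sequence `f` is equivalent to an energy `g` with `g (k + 1) ≤ q * g k`, then `f`
decays geometrically at rate `q`. No sign condition on `q` is needed, since `q < 0` forces `f = 0`. -/
lemma le_div_mul_pow_mul_of_equiv_of_succ_le_mul {f g : ℕ → ℝ} {b M q : ℝ} (hb : 0 < b)
    (hf : ∀ k, 0 ≤ f k) (hlow : ∀ k, b * f k ≤ g k) (hup : ∀ k, g k ≤ M * f k)
    (hq : ∀ k, g (k + 1) ≤ q * g k) (k : ℕ) : f k ≤ M / b * q ^ k * f 0 := by
  have hg : ∀ n, 0 ≤ g n := fun n => (mul_nonneg hb.le (hf n)).trans (hlow n)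
  rcases le_or_gt 0 q with h | h
  · have hdecay : g k ≤ q ^ k * g 0 := by
      induction k with
      | zero => simp
      | succ k ih =>
        calc g (k + 1) ≤ q * g k := hq k
          _ ≤ q * (q ^ k * g 0) := by gcongr
          _ = q ^ (k + 1) * g 0 := by ring
    calc f k ≤ g k / b := (le_div_iff₀' hb).2 (hlow k)
      _ ≤ q ^ k * (M * f 0) / b := by
        gcongr
        exact hdecay.trans (mul_le_mul_of_nonneg_left (hup 0) (pow_nonneg h k))
      _ = M / b * q ^ k * f 0 := by ring
  · have hzero : ∀ n, f n = 0 := fun n => by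
      have hgn : g n ≤ 0 := nonpos_of_mul_nonneg_right ((hg (n + 1)).trans (hq n)) h
      exact le_antisymm (nonpos_of_mul_nonpos_right ((hlow n).trans hgn) hb) (hf n)
    simp [hzero]

/-- If `BG * d ^ 2 ≤ x ≤ a * d`, then `x ≤ a ^ 2 / BG`. -/
lemma le_sq_div_of_mul_sq_le_of_le_mul {BG a d x : ℝ} (hBG : 0 < BG)
    (hlow : BG * d ^ 2 ≤ x) (hup : x ≤ a * d) : x ≤ a ^ 2 / BG := by
  rw [le_div_iff₀ hBG]
  nlinarith [sq_nonneg (a - BG * d)]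


/-- Convergence estimate in the original norm: under hypotheses (29)–(31)
on `Φ`, with `G` symmetric, continuous with constant `M_G > 0` and coercive with
constant `B_G > 0`, `γ ∈ (0, 2B_Φ B_G/D_Φ²)`, `ū` the solution of `Φ(ū, v) = L(v)` for
all `v`, and `(u^k)` generated by method (28), one has
`‖u^k − ū‖² ≤ (M_G/B_G) · q(γ)^{2k} · ‖u⁰ − ū‖²` for all `k`, where
`q(γ)² = 1 − (2γB_Φ − γ²D_Φ²/B_G)/M_G`. -/
theorem iterative_method_norm_estimate
    {V : Type*} [NormedAddCommGroup V] [InnerProductSpace ℝ V] [CompleteSpace V]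
    (Φ : V → V → ℝ)
    (hΦlin : ∀ u : V, IsLinearMap ℝ (Φ u))
    (h29 : ∀ u : V, ∃ RΦ > (0:ℝ), ∀ v : V, |Φ u v| ≤ RΦ * ‖v‖)
    (DΦ : ℝ) (hDΦ : DΦ > 0)
    (h30 : ∀ u v w : V, |Φ (u + w) v - Φ u v| ≤ DΦ * ‖w‖ * ‖v‖)
    (BΦ : ℝ) (hBΦ : BΦ > 0)
    (h31 : ∀ u v : V, Φ (u + v) v - Φ u v ≥ BΦ * ‖v‖ ^ 2)
    (G : V → V → ℝ)
    (hGlin₁ : ∀ u : V, IsLinearMap ℝ (G u))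
    (hGlin₂ : ∀ v : V, IsLinearMap ℝ (fun u => G u v))
    (hGsymm : ∀ u v : V, G u v = G v u)
    (MG : ℝ) (hMG : MG > 0)
    (hGcont : ∀ u v : V, |G u v| ≤ MG * ‖u‖ * ‖v‖)
    (BG : ℝ) (hBG : BG > 0)
    (hGcoer : ∀ u : V, G u u ≥ BG * ‖u‖ ^ 2)
    (L : V →L[ℝ] ℝ)
    (γ : ℝ) (hγ : γ ∈ Set.Ioo (0:ℝ) (2 * (BΦ * BG / DΦ ^ 2)))
    (ub : V) (hub : ∀ v : V, Φ ub v = L v)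
    (u : ℕ → V)
    (hstep : ∀ k : ℕ, ∀ v : V, G (u (k + 1)) v = G (u k) v - γ * (Φ (u k) v - L v)) :
    ∀ k : ℕ, ‖u k - ub‖ ^ 2 ≤
      (MG / BG) * (1 - (2 * γ * BΦ - γ ^ 2 * DΦ ^ 2 / BG) / MG) ^ k * ‖u 0 - ub‖ ^ 2 := by
  have hγ0 : 0 < γ := hγ.1
  have hGdiag : ∀ v, G v v ≤ MG * ‖v‖ ^ 2 := fun v => by
    rw [pow_two, ← mul_assoc]
    exact (le_abs_self _).trans (hGcont v v)
  have hcontraction : ∀ k, G (u (k + 1) - ub) (u (k + 1) - ub) ≤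
      (1 - (2 * γ * BΦ - γ ^ 2 * DΦ ^ 2 / BG) / MG) * G (u k - ub) (u k - ub) := by
    intro k
    set e := u k - ub with he
    set d := u k - u (k + 1) with hd
    have huk : ub + e = u k := by simp [he]
    have hGd : ∀ v, G d v = γ * (Φ (ub + e) v - Φ ub v) := fun v => by
      rw [hd, (hGlin₂ v).map_sub, hstep, huk, hub]
      ring
    have hexpand : G (u (k + 1) - ub) (u (k + 1) - ub) = G e e - 2 * G d e + G d d := by
      have hsub : u (k + 1) - ub = e - d := by simp [he, hd]
      rw [hsub, (hGlin₁ _).map_sub, (hGlin₂ e).map_sub, (hGlin₂ d).map_sub, hGsymm e d]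
      ring
    have hcross : γ * (BΦ * ‖e‖ ^ 2) ≤ G d e := by
      rw [hGd]
      exact mul_le_mul_of_nonneg_left (h31 ub e) hγ0.le
    have hquad : G d d ≤ (γ * (DΦ * ‖e‖)) ^ 2 / BG := by
      refine le_sq_div_of_mul_sq_le_of_le_mul hBG (hGcoer d) ?_
      rw [hGd, mul_assoc]
      exact mul_le_mul_of_nonneg_left ((le_abs_self _).trans (h30 ub d e)) hγ0.le
    have hrate : 0 < 2 * γ * BΦ - γ ^ 2 * DΦ ^ 2 / BG := by
      have hγ1 := hγ.2
      rw [← mul_div_assoc, lt_div_iff₀ (by positivity)] at hγ1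
      rw [sub_pos, div_lt_iff₀ hBG]
      nlinarith
    have hGe : G e e / MG ≤ ‖e‖ ^ 2 := (div_le_iff₀' hMG).2 (hGdiag e)
    calc G (u (k + 1) - ub) (u (k + 1) - ub)
        ≤ G e e - 2 * (γ * (BΦ * ‖e‖ ^ 2)) + (γ * (DΦ * ‖e‖)) ^ 2 / BG := by
          rw [hexpand]
          gcongr
      _ = G e e - (2 * γ * BΦ - γ ^ 2 * DΦ ^ 2 / BG) * ‖e‖ ^ 2 := by ring
      _ ≤ G e e - (2 * γ * BΦ - γ ^ 2 * DΦ ^ 2 / BG) * (G e e / MG) := by gcongr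
      _ = _ := by ring
  exact le_div_mul_pow_mul_of_equiv_of_succ_le_mul (f := fun k => ‖u k - ub‖ ^ 2) hBG
    (fun k => by positivity) (fun k => hGcoer _) (fun k => hGdiag _) hcontraction
end

section
/- Theorem 2 (abstract form, convergence of the penalty Robin–Robin domain decomposition scheme): let A : V × V → ℝ be a symmetric bilinear form, continuous with constant M_A > 0 and coercive with constant B_A > 0. Let H', J' : V → V → ℝ be linear in their second argument and satisfy: |H'(u+w,v) − H'(u,v)| ≤ D‖w‖‖v‖; A(v,v) − (H'(u+v,v) − H'(u,v)) ≥ B‖v‖² with B > 0; |J'(u+w,v) − J'(u,v)| ≤ D̃‖w‖‖v‖; J'(u+v,v) − J'(u,v) ≥ 0; and for each u there exist R, R̃ > 0 with |H'(u,v)| ≤ R‖v‖ and |J'(u,v)| ≤ R̃‖v‖ for all v. Let X : V × V → ℝ be a symmetric bilinear form that is continuous with constant M_X > 0 and nonnegative (X(u,u) ≥ 0 for all u), and set G := A + X, Φ(u,v) := A(u,v) − H'(u,v) + J'(u,v). Let L be a continuous linear form on V and let ū ∈ V be the unique solution of Φ(ū, v) = L(v) for all v ∈ V. Then for every γ ∈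 (0, 2 B B_A/(M_A + D + D̃)²), the sequence (u^k) defined from any u⁰ ∈ V by G(u^{k+1}, v) = G(u^k, v) − γ[Φ(u^k, v) − L(v)] for all v ∈ V converges strongly to ū. -/
/-- A nonnegative sequence dissipated by a nonnegative energy tends to zero. -/
theorem tendsto_zero_of_energy_descent {a g : ℕ → ℝ} {c : ℝ} (hc : 0 < c)
    (ha : ∀ k, 0 ≤ a k) (hg : ∀ k, 0 ≤ g k) (h : ∀ k, g (k + 1) + c * a k ≤ g k) :
    Filter.Tendsto a Filter.atTop (nhds 0) := by
  refine (summable_of_sum_range_le (c := g 0 / c) ha fun n => ?_).tendsto_atTop_zero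
  have key : g n + c * ∑ i ∈ Finset.range n, a i ≤ g 0 := by
    induction n with
    | zero => simp
    | succ n ih =>
      rw [Finset.sum_range_succ, mul_add]
      linarith [h n]
  rw [le_div_iff₀ hc]
  linarith [hg n]

/-- If `b * x ^ 2 ≤ q ≤ t * x`, then `q ≤ t ^ 2 / b`. -/
theorem le_sq_div_of_coercive_of_bounded {b q t x : ℝ} (hb : 0 < b)
    (hlow : b * x ^ 2 ≤ q) (hup : q ≤ t * x) : q ≤ t ^ 2 / b := by
  rw [le_div_iff₀ hb]
  nlinarith [sq_nonneg (t - b * x), mul_le_mul_of_nonneg_left hup hb.le,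
    mul_le_mul_of_nonneg_left hlow hb.le]

/-- Theorem 2, abstract form: convergence of the penalty Robin–Robin
domain decomposition scheme, i.e. of method (28) with `G = A + X` and
`Φ(u,v) = A(u,v) − H'(u,v) + J'(u,v)`, for `γ ∈ (0, 2 B B_A/(M_A + D + D̃)²)`. -/
theorem theorem2_penalty_robin_robin_convergence
    {V : Type*} [NormedAddCommGroup V] [InnerProductSpace ℝ V] [CompleteSpace V]
    (A : V → V → ℝ)
    (hAlin₁ : ∀ u : V, IsLinearMap ℝ (A u))
    (hAlin₂ : ∀ v : V, IsLinearMap ℝ (fun u => A u v))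
    (hAsymm : ∀ u v : V, A u v = A v u)
    (MA : ℝ) (hMA : MA > 0)
    (hAcont : ∀ u v : V, |A u v| ≤ MA * ‖u‖ * ‖v‖)
    (BA : ℝ) (hBA : BA > 0)
    (hAcoer : ∀ u : V, A u u ≥ BA * ‖u‖ ^ 2)
    (H' : V → V → ℝ) (J' : V → V → ℝ)
    (hH'lin : ∀ u : V, IsLinearMap ℝ (H' u))
    (hJ'lin : ∀ u : V, IsLinearMap ℝ (J' u))
    (D : ℝ) (hD : D > 0)
    (hH'lip : ∀ u v w : V, |H' (u + w) v - H' u v| ≤ D * ‖w‖ * ‖v‖)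
    (B : ℝ) (hB : B > 0)
    (hAH' : ∀ u v : V, A v v - (H' (u + v) v - H' u v) ≥ B * ‖v‖ ^ 2)
    (Dt : ℝ) (hDt : Dt > 0)
    (hJ'lip : ∀ u v w : V, |J' (u + w) v - J' u v| ≤ Dt * ‖w‖ * ‖v‖)
    (hJ'mono : ∀ u v : V, J' (u + v) v - J' u v ≥ 0)
    (hbound : ∀ u : V, ∃ R > (0:ℝ), ∃ Rt > (0:ℝ),
      (∀ v : V, |H' u v| ≤ R * ‖v‖) ∧ (∀ v : V, |J' u v| ≤ Rt * ‖v‖))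
    (X : V → V → ℝ)
    (hXlin₁ : ∀ u : V, IsLinearMap ℝ (X u))
    (hXlin₂ : ∀ v : V, IsLinearMap ℝ (fun u => X u v))
    (hXsymm : ∀ u v : V, X u v = X v u)
    (MX : ℝ) (hMX : MX > 0)
    (hXcont : ∀ u v : V, |X u v| ≤ MX * ‖u‖ * ‖v‖)
    (hXnonneg : ∀ u : V, X u u ≥ 0)
    (G : V → V → ℝ) (hG : ∀ u v : V, G u v = A u v + X u v)
    (Φ : V → V → ℝ) (hΦ : ∀ u v : V, Φ u v = A u v - H' u v + J' u v)
    (L : V →L[ℝ] ℝ)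
    (ub : V) (hub : ∀ v : V, Φ ub v = L v)
    (γ : ℝ) (hγ : γ ∈ Set.Ioo (0:ℝ) (2 * (B * BA / (MA + D + Dt) ^ 2)))
    (u : ℕ → V)
    (hstep : ∀ k : ℕ, ∀ v : V, G (u (k + 1)) v = G (u k) v - γ * (Φ (u k) v - L v)) :
    Filter.Tendsto u Filter.atTop (nhds ub) := by
  obtain ⟨hγ0, hγ1⟩ := hγ
  set M := MA + D + Dt with hM
  have hMpos : 0 < M := by positivity
  have hc : 0 < γ * (2 * B - γ * M ^ 2 / BA) := by
    refine mul_pos hγ0 (sub_pos.2 ?_)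
    rw [div_lt_iff₀ hBA]
    rw [← mul_div_assoc, lt_div_iff₀ (by positivity)] at hγ1
    linarith
  have hGadd₁ (x y v : V) : G (x + y) v = G x v + G y v := by
    simp only [hG, (hAlin₂ v).map_add, (hXlin₂ v).map_add]
    ring
  have hGadd₂ (x y v : V) : G v (x + y) = G v x + G v y := by
    simp only [hG, (hAlin₁ v).map_add, (hXlin₁ v).map_add]
    ring
  have hGsymm (x y : V) : G x y = G y x := by
    rw [hG, hG, hAsymm, hXsymm]
  have hGcoer (x : V) : BA * ‖x‖ ^ 2 ≤ G x x := by
    rw [hG]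
    linarith [hAcoer x, hXnonneg x]
  have hΦmono (e : V) : B * ‖e‖ ^ 2 ≤ Φ (ub + e) e - Φ ub e := by
    have hA := (hAlin₂ e).map_add ub e
    simp only [hΦ]
    linarith [hAH' ub e, hJ'mono ub e]
  have hΦlip (e v : V) : |Φ (ub + e) v - Φ ub v| ≤ M * ‖e‖ * ‖v‖ := by
    have hA := (hAlin₂ v).map_add ub e
    have h₁ := abs_le.1 (hAcont e v)
    have h₂ := abs_le.1 (hH'lip ub v e)
    have h₃ := abs_le.1 (hJ'lip ub v e)
    simp only [hΦ, hM, add_mul]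
    exact abs_le.2 ⟨by linarith, by linarith⟩
  have hdescent (k : ℕ) :
      G (u (k + 1) - ub) (u (k + 1) - ub) + γ * (2 * B - γ * M ^ 2 / BA) * ‖u k - ub‖ ^ 2
        ≤ G (u k - ub) (u k - ub) := by
    obtain ⟨e, he⟩ : ∃ e, u k = ub + e := ⟨u k - ub, by abel⟩
    obtain ⟨d, hd⟩ : ∃ d, u (k + 1) = ub + e + d := ⟨u (k + 1) - (ub + e), by abel⟩
    have hGd (v : V) : G d v = -γ * (Φ (ub + e) v - Φ ub v) := by
      have h := hstep k v
      rw [hd, he, hGadd₁, ← hub] at h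
      linarith
    have hdd : G d d ≤ (γ * M * ‖e‖) ^ 2 / BA := by
      refine le_sq_div_of_coercive_of_bounded hBA (hGcoer d) ?_
      have h := mul_le_mul_of_nonneg_left (neg_le_of_abs_le (hΦlip e d)) hγ0.le
      rw [hGd]
      linarith
    have hde : G d e ≤ -γ * (B * ‖e‖ ^ 2) := by
      have h := mul_le_mul_of_nonneg_left (hΦmono e) hγ0.le
      rw [hGd]
      linarith
    have hexp : G (e + d) (e + d) = G e e + 2 * G d e + G d d := by
      rw [hGadd₁, hGadd₂, hGadd₂, hGsymm e d]
      ring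
    have hcoef : γ * (2 * B - γ * M ^ 2 / BA) * ‖e‖ ^ 2
        = 2 * (γ * (B * ‖e‖ ^ 2)) - (γ * M * ‖e‖) ^ 2 / BA := by
      ring
    rw [hd, he, add_assoc, add_sub_cancel_left, add_sub_cancel_left, hexp, hcoef]
    linarith
  have hsq : Filter.Tendsto (fun k => ‖u k - ub‖ ^ 2) Filter.atTop (nhds 0) :=
    tendsto_zero_of_energy_descent (g := fun k => G (u k - ub) (u k - ub)) hc (fun _ => sq_nonneg _)
      (fun _ => (by positivity : (0 : ℝ) ≤ _).trans (hGcoer _)) hdescent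
  rw [tendsto_iff_norm_sub_tendsto_zero]
  simpa [Real.sqrt_sq] using hsq.sqrt
end

section
/- Mean-value coercivity transfer: let A : V × V → ℝ be a bilinear form, and let H' : V → V → ℝ and H'' : V → V → V → ℝ be maps such that for all u, v, w ∈ V and all t ∈ ℝ, the function t ↦ H'(u + t w, v) is differentiable with derivative H''(u + t w, w, v) at t. If there exists B > 0 such that A(v, v) − H''(u, v, v) ≥ B‖v‖² for all u, v ∈ V, then A(v, v) − (H'(u + v, v) − H'(u, v)) ≥ B‖v‖² for all u, v ∈ V. -/
/-- Mean-value coercivity transfer: if `t ↦ H'(u + t w, v)` is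
differentiable with derivative `H''(u + t w, w, v)` at every `t`, and
`A(v,v) − H''(u,v,v) ≥ B‖v‖²` for all `u, v`, then
`A(v,v) − (H'(u + v, v) − H'(u, v)) ≥ B‖v‖²` for all `u, v`. -/
theorem mean_value_coercivity_transfer
    {V : Type*} [NormedAddCommGroup V] [InnerProductSpace ℝ V] [CompleteSpace V]
    (A : V → V → ℝ)
    (hAlin₁ : ∀ u : V, IsLinearMap ℝ (A u))
    (hAlin₂ : ∀ v : V, IsLinearMap ℝ (fun u => A u v))
    (H' : V → V → ℝ) (H'' : V → V → V → ℝ)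
    (hderiv : ∀ u v w : V, ∀ t : ℝ,
      HasDerivAt (fun s : ℝ => H' (u + s • w) v) (H'' (u + t • w) w v) t)
    (B : ℝ) (hB : B > 0)
    (h19 : ∀ u v : V, A v v - H'' u v v ≥ B * ‖v‖ ^ 2) :
    ∀ u v : V, A v v - (H' (u + v) v - H' u v) ≥ B * ‖v‖ ^ 2 := by
  intro u v
  obtain ⟨c, -, hc⟩ := exists_hasDerivAt_eq_slope
    (fun s : ℝ => H' (u + s • v) v) (fun t : ℝ => H'' (u + t • v) v v) zero_lt_one
    (fun t _ => (hderiv u v v t).continuousAt.continuousWithinAt)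
    (fun t _ => hderiv u v v t)
  simp only [one_smul, zero_smul, add_zero, sub_zero, div_one] at hc
  rw [← hc]
  exact h19 (u + c • v) v
end

section
/- Unique solvability of the constrained minimization problem and equivalence with the variational inequality: let K ⊆ V be a nonempty closed convex set, let F : V → ℝ be continuous, and let F' : V → V → ℝ be such that F'(u, ·) is linear for each u, for each u there exists R > 0 with |F'(u,v)| ≤ R‖v‖ for all v, for all u, v ∈ V and t ∈ ℝ the function t ↦ F(u + t v) is differentiable with derivative F'(u + t v, v) at t, and there exists B > 0 with F'(u + v, v) − F'(u, v) ≥ B‖v‖² for all u, v. Then F attains a unique minimum over K at some ū ∈ K, and an element u ∈ K minimizes F over K if and only if F'(u, v − u) ≥ 0 for all v ∈ K. -/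
section GradientMonotone

variable {V : Type*} [NormedAddCommGroup V] [NormedSpace ℝ V] {F : V → ℝ} {F' : V → V → ℝ}

/-- A function whose directional derivative is strongly monotone lies above its tangents by a
quadratic term. -/
theorem add_deriv_add_sq_le_of_strongly_monotone
    (hlin : ∀ u, IsLinearMap ℝ (F' u))
    (hderiv : ∀ u v : V, ∀ t : ℝ,
      HasDerivAt (fun s : ℝ => F (u + s • v)) (F' (u + t • v) v) t)
    {B : ℝ} (hmono : ∀ u v : V, F' (u + v) v - F' u v ≥ B * ‖v‖ ^ 2) (u v : V) :
    F u + F' u v + B / 2 * ‖v‖ ^ 2 ≤ F (u + v) := by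
  have hd : ∀ t : ℝ, HasDerivAt
      (fun s : ℝ => F (u + s • v) - s * F' u v - B / 2 * ‖v‖ ^ 2 * s ^ 2)
      (F' (u + t • v) v - F' u v - B * ‖v‖ ^ 2 * t) t := by
    intro t
    have h := ((hderiv u v t).sub ((hasDerivAt_id t).mul_const (F' u v))).sub
      ((hasDerivAt_pow 2 t).const_mul (B / 2 * ‖v‖ ^ 2))
    refine h.congr_deriv ?_
    norm_num
    ring
  have hm : MonotoneOn
      (fun s : ℝ => F (u + s • v) - s * F' u v - B / 2 * ‖v‖ ^ 2 * s ^ 2) (Set.Ici 0) := by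
    refine monotoneOn_of_deriv_nonneg (convex_Ici 0)
      (fun t _ => (hd t).continuousAt.continuousWithinAt)
      (fun t _ => (hd t).differentiableAt.differentiableWithinAt) ?_
    intro t ht
    rw [interior_Ici, Set.mem_Ioi] at ht
    rw [(hd t).deriv]
    have h := hmono u (t • v)
    rw [(hlin _).map_smul, (hlin _).map_smul, norm_smul, mul_pow, Real.norm_eq_abs, sq_abs,
      smul_eq_mul, smul_eq_mul] at h
    refine nonneg_of_mul_nonneg_right (a := t) ?_ ht
    linarith
  have h := hm (Set.mem_Ici.2 le_rfl) (Set.mem_Ici.2 zero_le_one) zero_le_one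
  simp only [zero_smul, add_zero, one_smul] at h
  linarith

/-- A function whose directional derivative is strongly monotone is uniformly midpoint convex. -/
theorem midpoint_le_of_strongly_monotone
    (hlin : ∀ u, IsLinearMap ℝ (F' u))
    (hderiv : ∀ u v : V, ∀ t : ℝ,
      HasDerivAt (fun s : ℝ => F (u + s • v)) (F' (u + t • v) v) t)
    {B : ℝ} (hmono : ∀ u v : V, F' (u + v) v - F' u v ≥ B * ‖v‖ ^ 2) (x y : V) :
    2 * F (midpoint ℝ x y) + B / 4 * ‖x - y‖ ^ 2 ≤ F x + F y := by
  set m := midpoint ℝ x y with hm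
  set w := (2⁻¹ : ℝ) • (x - y) with hw
  have hx : m + w = x := by
    rw [hm, hw, midpoint_eq_smul_add, invOf_eq_inv]; module
  have hy : m + -w = y := by
    rw [hm, hw, midpoint_eq_smul_add, invOf_eq_inv]; module
  have h₁ := add_deriv_add_sq_le_of_strongly_monotone hlin hderiv hmono m w
  have h₂ := add_deriv_add_sq_le_of_strongly_monotone hlin hderiv hmono m (-w)
  rw [hx] at h₁
  rw [hy, (hlin m).map_neg, norm_neg] at h₂
  have hn : ‖w‖ = ‖x - y‖ / 2 := by
    rw [hw, norm_smul]; norm_num; ring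
  rw [hn] at h₁ h₂
  linarith

/-- A function whose directional derivative is strongly monotone and bounded at one point is
bounded below. -/
theorem bddBelow_range_of_strongly_monotone
    (hlin : ∀ u, IsLinearMap ℝ (F' u))
    (hderiv : ∀ u v : V, ∀ t : ℝ,
      HasDerivAt (fun s : ℝ => F (u + s • v)) (F' (u + t • v) v) t)
    {B : ℝ} (hB : 0 < B) (hmono : ∀ u v : V, F' (u + v) v - F' u v ≥ B * ‖v‖ ^ 2)
    {u : V} {R : ℝ} (hR : ∀ v, |F' u v| ≤ R * ‖v‖) :
    BddBelow (Set.range F) := by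
  refine ⟨F u - R ^ 2 / (2 * B), ?_⟩
  rintro _ ⟨x, rfl⟩
  have h := add_deriv_add_sq_le_of_strongly_monotone hlin hderiv hmono u (x - u)
  rw [add_sub_cancel] at h
  have h₁ := (abs_le.1 (hR (x - u))).1
  have h₂ : 0 ≤ R ^ 2 / (2 * B) - R * ‖x - u‖ + B / 2 * ‖x - u‖ ^ 2 := by
    have : R ^ 2 / (2 * B) - R * ‖x - u‖ + B / 2 * ‖x - u‖ ^ 2
        = (R - B * ‖x - u‖) ^ 2 / (2 * B) := by
      field_simp
      ring
    rw [this]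
    positivity
  linarith

/-- At a minimum over a convex set the derivative is nonnegative in feasible directions. -/
theorem deriv_nonneg_of_forall_le {K : Set V} (hK : Convex ℝ K)
    {u v : V} (hu : u ∈ K) (hv : v ∈ K) (hmin : ∀ w ∈ K, F u ≤ F w) {d : ℝ}
    (hd : HasDerivAt (fun s : ℝ => F (u + s • (v - u))) d 0) : 0 ≤ d := by
  refine ge_of_tendsto hd.tendsto_slope_zero_right ?_
  filter_upwards [Ioc_mem_nhdsGT (zero_lt_one' ℝ)] with t ht
  simp only [zero_add, zero_smul, add_zero, smul_eq_mul]
  exact mul_nonneg (inv_nonneg.2 ht.1.le)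
    (sub_nonneg.2 (hmin _ (hK.add_smul_sub_mem hu hv ⟨ht.1.le, ht.2⟩)))

/-- A continuous function that is bounded below and uniformly midpoint convex attains a minimum
over a nonempty closed convex set. -/
theorem exists_forall_le_of_midpoint_le [CompleteSpace V] {K : Set V} (hne : K.Nonempty)
    (hclosed : IsClosed K) (hconvex : Convex ℝ K) (hF : Continuous F)
    (hbdd : BddBelow (F '' K)) {c : ℝ} (hc : 0 < c)
    (hmid : ∀ x y, 2 * F (midpoint ℝ x y) + c * ‖x - y‖ ^ 2 ≤ F x + F y) :
    ∃ u ∈ K, ∀ v ∈ K, F u ≤ F v := by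
  set m := sInf (F '' K)
  have hle : ∀ v ∈ K, m ≤ F v := fun v hv => csInf_le hbdd ⟨v, hv, rfl⟩
  have hex : ∀ n : ℕ, ∃ x ∈ K, F x < m + 1 / ((n : ℝ) + 1) := by
    intro n
    obtain ⟨_, ⟨x, hx, rfl⟩, h⟩ := exists_lt_of_csInf_lt (hne.image F)
      (lt_add_of_pos_right m (Nat.one_div_pos_of_nat (α := ℝ) (n := n)))
    exact ⟨x, hx, h⟩
  choose x hxK hxF using hex
  have hcauchy : CauchySeq x := by
    refine cauchySeq_of_le_tendsto_0 (fun N : ℕ => √(2 / c * (1 / ((N : ℝ) + 1)))) ?_ ?_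
    · intro i j N hi hj
      rw [dist_eq_norm]
      refine Real.le_sqrt_of_sq_le ?_
      have h₁ := hmid (x i) (x j)
      have h₂ := hle _ (hconvex.midpoint_mem (hxK i) (hxK j))
      have h₃ := hxF i
      have h₄ := hxF j
      have h₅ := Nat.one_div_le_one_div (α := ℝ) hi
      have h₆ := Nat.one_div_le_one_div (α := ℝ) hj
      rw [div_mul_eq_mul_div, le_div_iff₀ hc]
      linarith
    · have h := ((tendsto_one_div_add_atTop_nhds_zero_nat (𝕜 := ℝ)).const_mul (2 / c)).sqrt
      simpa using h
  obtain ⟨u, hu⟩ := cauchySeq_tendsto_of_complete hcauchy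
  refine ⟨u, hclosed.mem_of_tendsto hu (Filter.Eventually.of_forall hxK), fun v hv => ?_⟩
  have hFu : F u ≤ m := by
    have h := (tendsto_one_div_add_atTop_nhds_zero_nat (𝕜 := ℝ)).const_add m
    rw [add_zero] at h
    exact le_of_tendsto_of_tendsto' ((hF.tendsto u).comp hu) h fun n => (hxF n).le
  exact hFu.trans (hle v hv)

end GradientMonotone

/-- Unique solvability of the constrained minimization problem and
equivalence with the variational inequality: if `K ⊆ V` is nonempty closed convex,
`F` is continuous, `F'(u,·)` is linear and bounded for each `u`, `t ↦ F(u + t v)` has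
derivative `F'(u + t v, v)` at `t`, and `F'` is strongly monotone, then `F` attains a
unique minimum over `K`, and `u ∈ K` minimizes `F` over `K` iff `F'(u, v − u) ≥ 0` for
all `v ∈ K`. -/
theorem constrained_minimization_unique_and_variational_inequality
    {V : Type*} [NormedAddCommGroup V] [InnerProductSpace ℝ V] [CompleteSpace V]
    (K : Set V) (hKne : K.Nonempty) (hKclosed : IsClosed K) (hKconvex : Convex ℝ K)
    (F : V → ℝ) (hFcont : Continuous F)
    (F' : V → V → ℝ)
    (hF'lin : ∀ u : V, IsLinearMap ℝ (F' u))
    (hF'bdd : ∀ u : V, ∃ R > (0:ℝ), ∀ v : V, |F' u v| ≤ R * ‖v‖)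
    (hFderiv : ∀ u v : V, ∀ t : ℝ,
      HasDerivAt (fun s : ℝ => F (u + s • v)) (F' (u + t • v) v) t)
    (B : ℝ) (hB : B > 0)
    (hmono : ∀ u v : V, F' (u + v) v - F' u v ≥ B * ‖v‖ ^ 2) :
    (∃! ub : V, ub ∈ K ∧ ∀ v ∈ K, F ub ≤ F v) ∧
    (∀ u ∈ K, (∀ v ∈ K, F u ≤ F v) ↔ (∀ v ∈ K, F' u (v - u) ≥ 0)) := by
  have hmid := midpoint_le_of_strongly_monotone hF'lin hFderiv hmono
  refine ⟨?_, fun u hu => ⟨fun hmin v hv => ?_, fun hvi v hv => ?_⟩⟩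
  · obtain ⟨R, -, hR⟩ := hF'bdd 0
    have hbdd : BddBelow (F '' K) :=
      (bddBelow_range_of_strongly_monotone hF'lin hFderiv hB hmono hR).mono
        (Set.image_subset_range F K)
    obtain ⟨u, hu, hmin⟩ := exists_forall_le_of_midpoint_le hKne hKclosed hKconvex hFcont hbdd
      (div_pos hB four_pos) hmid
    refine ⟨u, ⟨hu, hmin⟩, fun w ⟨hw, hwmin⟩ => ?_⟩
    have h₁ := hmid w u
    have h₂ := hmin _ (hKconvex.midpoint_mem hw hu)
    have h₃ := hwmin u hu
    have h₄ : B / 4 * ‖w - u‖ ^ 2 ≤ 0 := by linarith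
    have h₅ : ‖w - u‖ ^ 2 ≤ 0 := nonpos_of_mul_nonpos_right h₄ (div_pos hB four_pos)
    have h₆ : ‖w - u‖ = 0 := pow_eq_zero_iff two_ne_zero |>.1 (le_antisymm h₅ (sq_nonneg _))
    exact sub_eq_zero.1 (norm_eq_zero.1 h₆)
  · have hd := hFderiv u (v - u) 0
    rw [zero_smul, add_zero] at hd
    exact deriv_nonneg_of_forall_le hKconvex hu hv hmin hd
  · have h := add_deriv_add_sq_le_of_strongly_monotone hF'lin hFderiv hmono u (v - u)
    rw [add_sub_cancel] at h
    have h₁ := hvi v hv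
    have h₂ : 0 ≤ B / 2 * ‖v - u‖ ^ 2 := by positivity
    linarith
end

section
/- Convergence of the penalty method: let F : V → ℝ be continuous and B-strongly convex for some B > 0 (i.e. F(t u + (1−t) v) ≤ t F(u) + (1−t) F(v) − (B/2) t (1−t) ‖u − v‖² for all u, v ∈ V and t ∈ [0,1]); let j : V → ℝ be convex, continuous and nonnegative, and suppose K := {u ∈ V : j(u) = 0} is nonempty. For each θ > 0 let ū_θ be the unique minimizer of F + θ⁻¹ j over V, and let ū be the unique minimizer of F over K. Then ‖ū_θ − ū‖ → 0 as θ → 0⁺. -/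
/-- Quadratic growth of a strongly convex function away from a minimizer. -/
theorem StrongConvexOn.mul_sq_norm_sub_le_of_isMinOn
    {E : Type*} [NormedAddCommGroup E] [NormedSpace ℝ E] {s : Set E} {f : E → ℝ} {m : ℝ}
    (hf : StrongConvexOn s m f) {x y : E} (hx : x ∈ s) (hy : y ∈ s) (hmin : IsMinOn f s x) :
    m / 4 * ‖y - x‖ ^ 2 ≤ f y - f x := by
  have hhalf : (0 : ℝ) ≤ 1 / 2 := by norm_num
  have hsum : (1 / 2 : ℝ) + 1 / 2 = 1 := by norm_num
  have hmid := hf.2 hy hx hhalf hhalf hsum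
  have hle := isMinOn_iff.1 hmin _ (hf.1 hy hx hhalf hhalf hsum)
  simp only [smul_eq_mul] at hmid
  linarith

/-- Convergence of the penalty method: if `F` is continuous and
`B`-strongly convex, `j` is convex, continuous and nonnegative, the constraint set
`K = {u : j(u) = 0}` is nonempty, `ū_θ` minimizes `F + θ⁻¹ j` over `V` for every
`θ > 0`, and `ū` minimizes `F` over `K`, then `‖ū_θ − ū‖ → 0` as `θ → 0⁺`. -/
theorem penalty_method_convergence
    {V : Type*} [NormedAddCommGroup V] [InnerProductSpace ℝ V] [CompleteSpace V]
    (F : V → ℝ) (hFcont : Continuous F)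
    (B : ℝ) (hB : B > 0)
    (hFsc : ∀ u v : V, ∀ t ∈ Set.Icc (0:ℝ) 1,
      F (t • u + (1 - t) • v) ≤
        t * F u + (1 - t) * F v - (B / 2) * t * (1 - t) * ‖u - v‖ ^ 2)
    (j : V → ℝ) (hjconv : ConvexOn ℝ Set.univ j) (hjcont : Continuous j)
    (hjnonneg : ∀ u : V, 0 ≤ j u)
    (K : Set V) (hK : K = {u : V | j u = 0}) (hKne : K.Nonempty)
    (uθ : ℝ → V)
    (huθ : ∀ θ : ℝ, θ > 0 → ∀ v : V, F (uθ θ) + θ⁻¹ * j (uθ θ) ≤ F v + θ⁻¹ * j v)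
    (ub : V) (hubK : ub ∈ K) (hubmin : ∀ v ∈ K, F ub ≤ F v) :
    Filter.Tendsto (fun θ => ‖uθ θ - ub‖) (nhdsWithin 0 (Set.Ioi 0)) (nhds 0) := by
  subst hK
  have hF : StrongConvexOn Set.univ B F := by
    refine ⟨convex_univ, fun u _ v _ a b ha hb hab => ?_⟩
    obtain rfl : b = 1 - a := by linarith
    have h := hFsc u v a ⟨ha, by linarith⟩
    simp only [smul_eq_mul]
    linarith
  have hgrowth : ∀ θ > 0, ∀ v,
      B / 4 * ‖v - uθ θ‖ ^ 2 ≤ (F v + θ⁻¹ * j v) - (F (uθ θ) + θ⁻¹ * j (uθ θ)) := by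
    intro θ hθ v
    have hsc : StrongConvexOn Set.univ B (F + fun x => θ⁻¹ * j x) := by
      simpa [StrongConvexOn, ← Pi.zero_def] using UniformConvexOn.add hF
        (uniformConvexOn_zero.2 (hjconv.smul (inv_nonneg.2 hθ.le)))
    exact hsc.mul_sq_norm_sub_le_of_isMinOn (Set.mem_univ _) (Set.mem_univ v)
      (isMinOn_iff.2 fun w _ => huθ θ hθ w)
  set m : ℝ → ℝ := fun θ => F (uθ θ) + θ⁻¹ * j (uθ θ) with hm
  have hm_le : ∀ θ > 0, m θ ≤ F ub := fun θ hθ => by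
    have h := huθ θ hθ ub
    rwa [show j ub = 0 from hubK, mul_zero, add_zero] at h
  have hdist : ∀ θ > 0, ∀ θ' > 0, θ' ≤ θ → B / 4 * dist (uθ θ') (uθ θ) ^ 2 ≤ m θ' - m θ := by
    intro θ hθ θ' hθ' hle
    have hinv : θ⁻¹ * j (uθ θ') ≤ θ'⁻¹ * j (uθ θ') :=
      mul_le_mul_of_nonneg_right (inv_anti₀ hθ' hle) (hjnonneg _)
    have h := hgrowth θ hθ (uθ θ')
    rw [dist_eq_norm]
    simp only [hm]
    linarith
  have hbdd : BddAbove (m '' Set.Ioi 0) := ⟨F ub, by rintro _ ⟨θ, hθ, rfl⟩; exact hm_le θ hθ⟩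
  have hcauchy : Cauchy (Filter.map uθ (nhdsWithin 0 (Set.Ioi 0))) := by
    refine Metric.cauchy_iff.2 ⟨inferInstance, fun ε hε => ?_⟩
    obtain ⟨_, ⟨θ₀, hθ₀, rfl⟩, hlt⟩ := exists_lt_of_lt_csSup (Set.nonempty_Ioi.image m)
      (sub_lt_self (sSup (m '' Set.Ioi 0)) (show 0 < B / 4 * (ε / 2) ^ 2 by positivity))
    have hnear : ∀ θ ∈ Set.Ioo 0 θ₀, dist (uθ θ) (uθ θ₀) < ε / 2 := by
      intro θ hθ
      have h := hdist θ₀ hθ₀ θ hθ.1 hθ.2.le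
      have hsup : m θ ≤ sSup (m '' Set.Ioi 0) := le_csSup hbdd ⟨θ, hθ.1, rfl⟩
      have hsq : dist (uθ θ) (uθ θ₀) ^ 2 < (ε / 2) ^ 2 :=
        lt_of_mul_lt_mul_left (by linarith) (show 0 ≤ B / 4 by positivity)
      exact lt_of_pow_lt_pow_left₀ 2 (by positivity) hsq
    refine ⟨uθ '' Set.Ioo 0 θ₀, Filter.image_mem_map (Ioo_mem_nhdsGT hθ₀), ?_⟩
    rintro _ ⟨θ, hθ, rfl⟩ _ ⟨θ', hθ', rfl⟩
    have htri := dist_triangle_right (uθ θ) (uθ θ') (uθ θ₀)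
    linarith [hnear θ hθ, hnear θ' hθ']
  obtain ⟨w, hw⟩ := CompleteSpace.complete hcauchy
  have hlim : Filter.Tendsto uθ (nhdsWithin 0 (Set.Ioi 0)) (nhds w) := hw
  have hFlim := (hFcont.tendsto w).comp hlim
  have hjlim := (hjcont.tendsto w).comp hlim
  have hid : Filter.Tendsto (fun θ : ℝ => θ) (nhdsWithin 0 (Set.Ioi 0)) (nhds 0) :=
    nhdsWithin_le_nhds
  have hjw : j w ≤ 0 := by
    have hbound : Filter.Tendsto (fun θ => θ * (F ub - F (uθ θ)))
        (nhdsWithin 0 (Set.Ioi 0)) (nhds 0) := by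
      simpa using hid.mul (hFlim.const_sub (F ub))
    refine le_of_tendsto_of_tendsto hjlim hbound ?_
    filter_upwards [self_mem_nhdsWithin] with θ hθ
    have h : θ⁻¹ * j (uθ θ) ≤ F ub - F (uθ θ) := by linarith [hm_le θ hθ]
    exact (inv_mul_le_iff₀ hθ).1 h
  have hFw : F w ≤ F ub := by
    refine le_of_tendsto hFlim ?_
    filter_upwards [self_mem_nhdsWithin] with θ hθ
    have h : 0 ≤ θ⁻¹ * j (uθ θ) := mul_nonneg (inv_nonneg.2 (le_of_lt hθ)) (hjnonneg _)
    simp only [Function.comp_apply]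
    linarith [hm_le θ hθ]
  have hwK : w ∈ {u : V | j u = 0} := le_antisymm hjw (hjnonneg w)
  have hKconv : Convex ℝ {u : V | j u = 0} := by
    have hset : {u : V | j u = 0} = {u ∈ Set.univ | j u ≤ 0} := by
      ext u
      simp [le_antisymm_iff, hjnonneg u]
    rw [hset]
    exact hjconv.convex_le 0
  have hFK : StrongConvexOn {u : V | j u = 0} B F :=
    ⟨hKconv, fun _ _ _ _ => hF.2 (Set.mem_univ _) (Set.mem_univ _)⟩
  have hwub : w = ub := by
    have h := hFK.mul_sq_norm_sub_le_of_isMinOn hubK hwK (isMinOn_iff.2 hubmin)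
    have hsq : ‖w - ub‖ ^ 2 ≤ 0 :=
      le_of_mul_le_mul_left (by linarith) (show 0 < B / 4 by positivity)
    exact sub_eq_zero.1 (norm_eq_zero.1 (pow_eq_zero_iff two_ne_zero |>.1
      (le_antisymm hsq (sq_nonneg _))))
  exact tendsto_iff_norm_sub_tendsto_zero.1 (hwub ▸ hlim)
end

section
/- Gateaux differentiability of the L² contact penalty: let (X, μ) be a measure space and let d, u, v ∈ L²(μ; ℝ). Define j(u) := (1/2) ∫ ((d − u)⁻)² dμ, where y⁻ := min(y, 0). Then for all u, v ∈ L²(μ; ℝ), the function t ↦ j(u + t v) is differentiable at every t ∈ ℝ with derivative −∫ (d − u − t v)⁻ · v dμ; in particular j is Gateaux differentiable with differential j'(u, v) = −∫ (d − u)⁻ · v dμ. -/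
open MeasureTheory

theorem hasDerivAt_half_sq_min_zero (y : ℝ) :
    HasDerivAt (fun y : ℝ => (1 / 2) * (min y 0) ^ 2) (min y 0) y := by
  rw [hasDerivAt_iff_isLittleO_nhds_zero]
  refine Asymptotics.IsBigO.trans_isLittleO (g := fun h : ℝ => h ^ 2) ?_
    (Asymptotics.isLittleO_pow_id one_lt_two)
  refine Asymptotics.IsBigO.of_bound 1 (Filter.Eventually.of_forall fun h => ?_)
  rw [smul_eq_mul, one_mul, Real.norm_eq_abs, Real.norm_eq_abs, abs_of_nonneg (sq_nonneg h),
    abs_le]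
  rcases min_cases (y + h) 0 with ⟨h₁, h₂⟩ | ⟨h₁, h₂⟩ <;>
    rcases min_cases y 0 with ⟨h₃, h₄⟩ | ⟨h₃, h₄⟩ <;> rw [h₁, h₃] <;>
    constructor <;> nlinarith [sq_nonneg h, sq_nonneg y, sq_nonneg (y + h)]

theorem abs_min_zero_le_abs (y : ℝ) : |min y 0| ≤ |y| := by
  simpa using abs_min_sub_min_le_max y 0 0 0

theorem hasDerivAt_integral_half_sq_min_zero {X : Type*} [MeasurableSpace X] {μ : Measure X}
    {w v : X → ℝ} (hw : MemLp w 2 μ) (hv : MemLp v 2 μ) (t : ℝ) :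
    HasDerivAt (fun s : ℝ => ∫ x, (1 / 2) * (min (w x - s * v x) 0) ^ 2 ∂μ)
      (-∫ x, min (w x - t * v x) 0 * v x ∂μ) t := by
  have hmeas : ∀ s : ℝ, AEStronglyMeasurable (fun x => min (w x - s * v x) 0) μ := fun s =>
    (hw.1.sub (hv.1.const_mul s)).inf aestronglyMeasurable_const
  have hmin : MemLp (fun x => min (w x - t * v x) 0) 2 μ :=
    (hw.sub (hv.const_mul t)).mono (hmeas t)
      (Filter.Eventually.of_forall fun x => abs_min_zero_le_abs _)
  have hbound : Integrable (fun x => |w x * v x| + (|t| + 1) * (v x) ^ 2) μ :=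
    (hw.integrable_mul hv).abs.add (hv.integrable_sq.const_mul _)
  rw [← integral_neg]
  refine (hasDerivAt_integral_of_dominated_loc_of_deriv_le
    (F' := fun s x => -(min (w x - s * v x) 0 * v x)) (Metric.ball_mem_nhds t one_pos)
    (Filter.Eventually.of_forall fun s => ((hmeas s).pow 2).const_mul _)
    (hmin.integrable_sq.const_mul _) ((hmeas t).mul hv.1).neg
    (Filter.Eventually.of_forall fun x s hs => ?_) hbound
    (Filter.Eventually.of_forall fun x s _ => ?_)).2
  · have hs' : |s| ≤ |t| + 1 := by
      rw [Metric.mem_ball, Real.dist_eq] at hs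
      linarith [abs_sub_abs_le_abs_sub s t]
    calc ‖-(min (w x - s * v x) 0 * v x)‖ = |min (w x - s * v x) 0| * |v x| := by
          rw [norm_neg, Real.norm_eq_abs, abs_mul]
      _ ≤ (|w x| + |s| * |v x|) * |v x| := by
          gcongr
          exact (abs_min_zero_le_abs _).trans ((abs_sub _ _).trans_eq (by rw [abs_mul]))
      _ = |w x * v x| + |s| * (v x) ^ 2 := by rw [abs_mul, ← sq_abs (v x)]; ring
      _ ≤ |w x * v x| + (|t| + 1) * (v x) ^ 2 := by gcongr
  · have hlin : HasDerivAt (fun s : ℝ => w x - s * v x) (-v x) s := by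
      simpa using ((hasDerivAt_id s).mul_const (v x)).const_sub (w x)
    exact ((hasDerivAt_half_sq_min_zero (w x - s * v x)).comp s hlin).congr_deriv (mul_neg _ _)

/-- Gateaux differentiability of the L² contact penalty
`j(u) = (1/2) ∫ ((d − u)⁻)² dμ`, where `y⁻ = min(y, 0)`: for all `u, v ∈ L²(μ; ℝ)`,
`t ↦ j(u + t v)` is differentiable at every `t ∈ ℝ` with derivative
`−∫ (d − u − t v)⁻ · v dμ`; in particular the Gateaux differential at `u` is
`j'(u, v) = −∫ (d − u)⁻ · v dμ`. -/
theorem l2_contact_penalty_gateaux_differentiable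
    {X : Type*} [MeasurableSpace X] (μ : Measure X)
    (d : Lp ℝ 2 μ)
    (j : Lp ℝ 2 μ → ℝ)
    (hj : ∀ u : Lp ℝ 2 μ, j u = (1 / 2) * ∫ x, (min (d x - u x) 0) ^ 2 ∂μ) :
    ∀ u v : Lp ℝ 2 μ,
      (∀ t : ℝ, HasDerivAt (fun s : ℝ => j (u + s • v))
        (-∫ x, min (d x - u x - t * v x) 0 * v x ∂μ) t) ∧
      HasDerivAt (fun s : ℝ => j (u + s • v))
        (-∫ x, min (d x - u x) 0 * v x ∂μ) 0 := by
  intro u v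
  have hderiv : ∀ t : ℝ, HasDerivAt (fun s : ℝ => j (u + s • v))
      (-∫ x, min (d x - u x - t * v x) 0 * v x ∂μ) t := by
    intro t
    refine (hasDerivAt_integral_half_sq_min_zero ((Lp.memLp d).sub (Lp.memLp u))
      (Lp.memLp v) t).congr_of_eventuallyEq (Filter.Eventually.of_forall fun s => ?_)
    dsimp only
    rw [hj, ← integral_const_mul]
    refine integral_congr_ae ?_
    filter_upwards [Lp.coeFn_add u (s • v), Lp.coeFn_smul s v] with x hadd hsmul
    simp only [hadd, hsmul, Pi.add_apply, Pi.sub_apply, Pi.smul_apply, smul_eq_mul, sub_sub]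
  exact ⟨hderiv, by simpa using hderiv 0⟩
end

section
/- Monotonicity and Lipschitz continuity of the L² penalty differential: let (X, μ) be a measure space, d ∈ L²(μ; ℝ), and define j'(u, v) := −∫ (d − u)⁻ · v dμ for u, v ∈ L²(μ; ℝ), where y⁻ := min(y, 0). Then for all u, v, w ∈ L²(μ; ℝ): (a) j'(u + v, v) − j'(u, v) ≥ 0; (b) |j'(u + w, v) − j'(u, v)| ≤ ‖w‖_{L²} ‖v‖_{L²}. -/
open MeasureTheory

/-- The penalty differential written as an inner product with the lattice infimum in `L²`. -/
theorem integral_min_sub_zero_mul_eq_inner {X : Type*} [MeasurableSpace X] {μ : Measure X}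
    (d u v : Lp ℝ 2 μ) :
    ∫ x, min (d x - u x) 0 * v x ∂μ = inner ℝ v ((d - u) ⊓ 0) := by
  rw [L2.inner_def]
  refine integral_congr_ae ?_
  filter_upwards [Lp.coeFn_inf (d - u) 0, Lp.coeFn_sub d u, Lp.coeFn_zero ℝ 2 μ]
    with x h_inf h_sub h_zero
  simp only [h_inf, h_sub, h_zero, Pi.sub_apply, Pi.inf_apply, Pi.zero_apply,
    RCLike.inner_apply, conj_trivial]

/-- Monotonicity of the negative part, tested against the increment. -/
theorem inner_sub_inf_zero_sub_nonneg {X : Type*} [MeasurableSpace X] {μ : Measure X}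
    (f v : Lp ℝ 2 μ) : 0 ≤ inner ℝ v (f ⊓ 0 - (f - v) ⊓ 0) := by
  rw [L2.inner_def]
  refine integral_nonneg_of_ae ?_
  filter_upwards [Lp.coeFn_sub (f ⊓ 0) ((f - v) ⊓ 0), Lp.coeFn_inf f 0,
    Lp.coeFn_inf (f - v) 0, Lp.coeFn_sub f v, Lp.coeFn_zero ℝ 2 μ]
    with x h_diff h_inf h_inf' h_sub h_zero
  simp only [h_diff, h_inf, h_inf', h_sub, h_zero, Pi.sub_apply, Pi.inf_apply, Pi.zero_apply,
    RCLike.inner_apply, conj_trivial]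
  rw [mul_comm]
  rcases le_total 0 (v x) with hv | hv
  · exact mul_nonneg hv (sub_nonneg.2 (inf_le_inf_right 0 (by linarith)))
  · exact mul_nonneg_of_nonpos_of_nonpos hv (sub_nonpos.2 (inf_le_inf_right 0 (by linarith)))

/-- Monotonicity and Lipschitz continuity of the L² penalty differential
`j'(u, v) = −∫ (d − u)⁻ · v dμ`, where `y⁻ = min(y, 0)`: for all `u, v, w ∈ L²(μ; ℝ)`,
(a) `j'(u + v, v) − j'(u, v) ≥ 0`;
(b) `|j'(u + w, v) − j'(u, v)| ≤ ‖w‖_{L²} ‖v‖_{L²}`. -/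
theorem l2_penalty_differential_monotone_and_lipschitz
    {X : Type*} [MeasurableSpace X] (μ : Measure X)
    (d : Lp ℝ 2 μ)
    (j' : Lp ℝ 2 μ → Lp ℝ 2 μ → ℝ)
    (hj' : ∀ u v : Lp ℝ 2 μ, j' u v = -∫ x, min (d x - u x) 0 * v x ∂μ) :
    (∀ u v : Lp ℝ 2 μ, j' (u + v) v - j' u v ≥ 0) ∧
    (∀ u v w : Lp ℝ 2 μ, |j' (u + w) v - j' u v| ≤ ‖w‖ * ‖v‖) := by
  have h_diff : ∀ u v w : Lp ℝ 2 μ,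
      j' (u + w) v - j' u v = inner ℝ v ((d - u) ⊓ 0 - (d - u - w) ⊓ 0) := by
    intro u v w
    rw [hj', hj', integral_min_sub_zero_mul_eq_inner, integral_min_sub_zero_mul_eq_inner,
      inner_sub_right, sub_add_eq_sub_sub]
    ring
  refine ⟨fun u v => ?_, fun u v w => ?_⟩
  · rw [h_diff]
    exact inner_sub_inf_zero_sub_nonneg (d - u) v
  · have h_lip : ‖(d - u) ⊓ 0 - (d - u - w) ⊓ 0‖ ≤ ‖w‖ := by
      simpa using norm_inf_sub_inf_le_norm (d - u) (d - u - w) 0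
    rw [h_diff, mul_comm]
    exact (abs_real_inner_le_norm _ _).trans (by gcongr)
end
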